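/- For every real number t, the function σ ↦ η(σ + it) is not constant on the open interval (0,1); equivalently, there exist real numbers α₁, α₂ with 0 < α₁ ≤ 1/2 ≤ α₂ < 1 such that η(α₁ + it) ≠ η(α₂ + it). -/

import Mathlib

open Complex

/-- The Dirichlet eta function, defined via `η(s) = (1 - 2^(1-s)) · ζ(s)`. -/
noncomputable def dirichletEta (s : ℂ) : ℂ := (1 - (2 : ℂ) ^ (1 - s)) * riemannZeta s

/-- The Dirichlet eta function is analytic away from `s = 1`. -/
theorem analyticOnNhd_dirichletEta : AnalyticOnNhd ℂ dirichletEta {1}ᶜ := by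
  refine DifferentiableOn.analyticOnNhd (fun s hs ↦ ?_) isOpen_compl_singleton
  have hpow : DifferentiableAt ℂ (fun s : ℂ ↦ 1 - (2 : ℂ) ^ (1 - s)) s :=
    (((differentiableAt_const 1).sub differentiableAt_id).const_cpow
      (Or.inl two_ne_zero)).const_sub 1
  exact (hpow.mul (differentiableAt_riemannZeta hs)).differentiableWithinAt

theorem dirichletEta_zero : dirichletEta 0 = 1 / 2 := by
  norm_num [dirichletEta, riemannZeta_zero]

theorem dirichletEta_neg_two : dirichletEta (-2) = 0 := by
  have h : riemannZeta (-2) = 0 := by simpa using riemannZeta_neg_two_mul_nat_add_one 0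
  simp [dirichletEta, h]

/-- The Dirichlet eta function does not take any value frequently near a point other than `1`. -/
theorem not_frequently_dirichletEta_eq {z : ℂ} (hz : z ≠ 1) (c : ℂ) :
    ¬ ∃ᶠ s in nhdsWithin z {z}ᶜ, dirichletEta s = c := by
  intro h
  have heq : Set.EqOn dirichletEta (fun _ ↦ c) {1}ᶜ :=
    analyticOnNhd_dirichletEta.eqOn_of_preconnected_of_frequently_eq analyticOnNhd_const
      (isConnected_compl_singleton_of_one_lt_rank (by simp) 1).isPreconnected hz h
  have h0 : dirichletEta 0 = c := heq (by simp)
  have h2 : dirichletEta (-2) = c := heq (by norm_num)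
  rw [dirichletEta_zero, ← h2, dirichletEta_neg_two] at h0
  norm_num at h0

theorem eta_not_constant_on_horizontal_line (t : ℝ) :
    ∃ α₁ α₂ : ℝ, 0 < α₁ ∧ α₁ ≤ 1 / 2 ∧ 1 / 2 ≤ α₂ ∧ α₂ < 1 ∧
      dirichletEta (α₁ + t * Complex.I) ≠ dirichletEta (α₂ + t * Complex.I) := by
  by_contra! hconst
  set line : ℝ → ℂ := fun σ ↦ σ + t * Complex.I with hline
  have hinj : Function.Injective line := fun a b hab ↦ by simpa [hline] using hab
  have hcont : Continuous line := by fun_prop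
  have hne : line (1 / 2) ≠ 1 := fun h ↦ by
    have := congrArg Complex.re h
    norm_num [hline] at this
  have htendsto : Filter.Tendsto line (nhdsWithin (1 / 2) {1 / 2}ᶜ)
      (nhdsWithin (line (1 / 2)) {line (1 / 2)}ᶜ) :=
    hcont.continuousAt.continuousWithinAt.tendsto_nhdsWithin fun _ h ↦ hinj.ne h
  refine not_frequently_dirichletEta_eq hne (dirichletEta (line (1 / 2)))
    (htendsto.frequently (Filter.Eventually.frequently ?_))
  filter_upwards [nhdsWithin_le_nhds (Ioo_mem_nhds (by norm_num : (0 : ℝ) < 1 / 2)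
    (by norm_num : (1 / 2 : ℝ) < 1))] with σ hσ
  rcases le_total σ (1 / 2) with h | h
  · exact hconst σ (1 / 2) hσ.1 h le_rfl (by norm_num)
  · exact (hconst (1 / 2) σ (by norm_num) le_rfl h hσ.2).symm
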